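/- arXiv:1309.1112 — 4 statements merged into one kernel-verified Lean document; each statement's English description precedes it below -/
import Mathlib

section
/- If δ > 0 is small enough, there exist h₀ > 0, R₀ > 0, and a function φ = φ(r) ∈ C^∞([0,∞)) with φ' ≥ 0 and supp φ' = [0, R₀], such that for all h ∈ (0, h₀], almost every r > 0, and almost every ω ∈ S^{n-1}: ∂_r( w(r) (E - V_h(r,ω) + φ'(r)² - h φ''(r)) ) ≥ E w'(r)/4, where the left-hand side is interpreted using the distributional r-derivative ∂_rV ∈ L^∞. -/
open MeasureTheory Real Set

/-- The function `w(r) = 1 - (1+r)^{-δ}`. -/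
noncomputable def w (δ r : ℝ) : ℝ := 1 - (1 + r) ^ (-δ)

/-- Its derivative `w'(r) = δ (1+r)^{-1-δ}`. -/
noncomputable def wd (δ r : ℝ) : ℝ := δ * (1 + r) ^ (-1 - δ)

theorem exists_bound_deriv_smoothTransition :
    ∃ L > (0 : ℝ), ∀ x, |deriv smoothTransition x| ≤ L := by
  have hsm : ContDiff ℝ (⊤ : ℕ∞) smoothTransition := smoothTransition.contDiff
  have hcont : Continuous (deriv smoothTransition) :=
    (contDiff_infty_iff_deriv.mp hsm).2.continuous
  obtain ⟨C, hC⟩ := isCompact_Icc.exists_bound_of_continuousOn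
    (s := Icc (0 : ℝ) 1) hcont.continuousOn
  refine ⟨max C 1, by positivity, fun x => ?_⟩
  by_cases hx : x ∈ Icc (0 : ℝ) 1
  · exact (hC x hx).trans (le_max_left _ _)
  · have h0 : deriv smoothTransition x = 0 := by
      rcases lt_or_ge x 0 with h | h
      · have : smoothTransition =ᶠ[nhds x] fun _ => 0 := by
          filter_upwards [Iio_mem_nhds h] with y hy
          exact smoothTransition.zero_of_nonpos (le_of_lt hy)
        rw [this.deriv_eq, deriv_const]
      · have h1 : 1 < x := by
          by_contra h'
          exact hx ⟨h, not_lt.mp h'⟩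
        have : smoothTransition =ᶠ[nhds x] fun _ => 1 := by
          filter_upwards [Ioi_mem_nhds h1] with y hy
          exact smoothTransition.one_of_one_le (le_of_lt hy)
        rw [this.deriv_eq, deriv_const]
    rw [h0, abs_zero]
    positivity

theorem wd_pos {δ r : ℝ} (hδ : 0 < δ) (hr : 0 ≤ r) : 0 < wd δ r := by
  unfold wd
  positivity

theorem w_pos {δ r : ℝ} (hδ : 0 < δ) (hr : 0 < r) : 0 < w δ r :=
  sub_pos.mpr (rpow_lt_one_of_one_lt_of_neg (by linarith) (by linarith))

theorem w_le {δ r : ℝ} (hr : 0 < r) : w δ r ≤ δ * log (1 + r) := by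
  have := add_one_le_exp (log (1 + r) * -δ)
  unfold w
  rw [rpow_def_of_pos (by linarith)]
  linarith

theorem hasDerivAt_w {δ r : ℝ} (hr : 0 ≤ r) : HasDerivAt (w δ) (wd δ r) r := by
  have h1 : HasDerivAt (fun t : ℝ => 1 + t) 1 r := (hasDerivAt_id r).const_add 1
  have h := (h1.rpow_const (p := -δ) (Or.inl (by linarith))).const_sub 1
  refine h.congr_deriv ?_
  unfold wd
  rw [show -1 - δ = -δ - 1 by ring]
  ring

theorem contDiffAt_w {δ r : ℝ} (hr : 0 ≤ r) : ContDiffAt ℝ (⊤ : ℕ∞) (w δ) r :=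
  contDiffAt_const.sub
    ((contDiffAt_const.add contDiffAt_id).rpow_const_of_ne (by simp; linarith))

theorem w_lt_half_iff {δ r : ℝ} (hδ : 0 < δ) (hr : 0 ≤ r) :
    w δ r < 1 / 2 ↔ r < 2 ^ (1 / δ) - 1 := by
  have h2 : (1 / 2 : ℝ) = ((2 : ℝ) ^ (1 / δ)) ^ (-δ) := by
    rw [← rpow_mul (by norm_num), show 1 / δ * -δ = -1 by field_simp, rpow_neg_one]
    norm_num
  have h3 : w δ r < 1 / 2 ↔ ((2 : ℝ) ^ (1 / δ)) ^ (-δ) < (1 + r) ^ (-δ) := by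
    unfold w
    rw [← h2]
    constructor <;> intro h <;> linarith
  rw [h3, rpow_lt_rpow_iff_of_neg (by positivity) (by positivity) (by linarith)]
  constructor <;> intro h <;> linarith

/-- The potential contribution is dominated by `w'` times a decaying power. -/
theorem potential_le {δ δ₀ r v v' : ℝ} (hδ : 0 < δ) (hδ₀ : 0 < δ₀) (hδδ₀ : δ ≤ δ₀ / 2)
    (hr : 0 < r) (hv : v ≤ (1 + r) ^ (-δ₀)) (hv' : v' ≤ (1 + r) ^ (-1 - δ₀)) :
    wd δ r * v + w δ r * v' ≤ wd δ r * ((1 + 4 / δ₀) * (1 + r) ^ (-(δ₀ / 4))) := by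
  have hx : 1 < 1 + r := by linarith
  have hx0 : 0 < 1 + r := by linarith
  have hw := w_le (δ := δ) hr
  have hwp := w_pos hδ hr
  have hwd := wd_pos hδ hr.le
  have hlog : 0 ≤ log (1 + r) := log_nonneg hx.le
  have h1 : (1 + r) ^ (-δ₀) ≤ (1 + r) ^ (-(δ₀ / 4)) :=
    rpow_le_rpow_of_exponent_le hx.le (by linarith)
  have h2 : (1 + r) ^ (δ - δ₀) * log (1 + r) ≤ 4 / δ₀ * (1 + r) ^ (-(δ₀ / 4)) := by
    have ha : (1 + r) ^ (δ - δ₀) ≤ (1 + r) ^ (-(δ₀ / 2)) :=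
      rpow_le_rpow_of_exponent_le hx.le (by linarith)
    have hb : log (1 + r) ≤ (1 + r) ^ (δ₀ / 4) / (δ₀ / 4) :=
      log_le_rpow_div hx0.le (by positivity)
    calc (1 + r) ^ (δ - δ₀) * log (1 + r)
        ≤ (1 + r) ^ (-(δ₀ / 2)) * ((1 + r) ^ (δ₀ / 4) / (δ₀ / 4)) := by gcongr
      _ = 4 / δ₀ * ((1 + r) ^ (-(δ₀ / 2)) * (1 + r) ^ (δ₀ / 4)) := by field_simp
      _ = 4 / δ₀ * (1 + r) ^ (-(δ₀ / 4)) := by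
        rw [← rpow_add hx0]
        ring_nf
  have h3 : w δ r * v' ≤ wd δ r * ((1 + r) ^ (δ - δ₀) * log (1 + r)) := by
    calc w δ r * v' ≤ w δ r * (1 + r) ^ (-1 - δ₀) := by gcongr
      _ ≤ δ * log (1 + r) * (1 + r) ^ (-1 - δ₀) := by gcongr
      _ = wd δ r * ((1 + r) ^ (δ - δ₀) * log (1 + r)) := by
        unfold wd
        rw [show -1 - δ₀ = (-1 - δ) + (δ - δ₀) by ring, rpow_add hx0]
        ring
  calc wd δ r * v + w δ r * v'
      ≤ wd δ r * (1 + r) ^ (-(δ₀ / 4)) + wd δ r * (4 / δ₀ * (1 + r) ^ (-(δ₀ / 4))) := by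
        refine add_le_add ?_ (h3.trans (by gcongr))
        gcongr
        exact hv.trans h1
    _ = _ := by ring

/-- A smooth cutoff equal to `1` up to `R`, supported in `w ≤ 1/2`, whose logarithmic derivative
with respect to `w` is as small as we like provided `w R` is small. -/
theorem exists_cutoff {L A δ R : ℝ} (hL : ∀ x, |deriv smoothTransition x| ≤ L) (hA : 0 < A)
    (hδ : 0 < δ) (hR : 0 < R) (hδR : δ * log (1 + R) ≤ exp (-A) / 2) :
    ∃ χ : ℝ → ℝ, ContDiff ℝ (⊤ : ℕ∞) χ ∧ (∀ r, 0 ≤ χ r) ∧ (∀ r, χ r ≤ 1) ∧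
      (∀ r ≤ R, χ r = 1) ∧
      (∀ r, 0 ≤ r → (χ r ≠ 0 ↔ r < 2 ^ (1 / δ) - 1)) ∧
      ∀ r, 0 < r → |w δ r * deriv χ r| ≤ L / A * wd δ r := by
  set g : ℝ → ℝ := fun r => smoothTransition ((log (1 / 2) - log (w δ r)) / A)
  have hw_small : ∀ r, 0 < r → r ≤ R → w δ r ≤ exp (-A) / 2 := fun r hr hrR =>
    (w_le hr).trans (le_trans (by gcongr) hδR)
  have hg1 : ∀ r, 0 < r → r ≤ R → g r = 1 := by
    intro r hr hrR
    apply smoothTransition.one_of_one_le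
    rw [le_div_iff₀ hA]
    have h := log_le_log (w_pos hδ hr) (hw_small r hr hrR)
    rw [log_div (exp_pos _).ne' two_ne_zero, log_exp] at h
    rw [one_div, log_inv]
    linarith
  set χ : ℝ → ℝ := fun r => if r ≤ R then 1 else g r with hχ
  have hχR : ∀ r ≤ R, χ r = 1 := fun r hr => if_pos hr
  have hχg : ∀ r, 0 < r → χ r = g r := by
    intro r hr
    by_cases h : r ≤ R
    · rw [hχR r h, hg1 r hr h]
    · exact if_neg h
  have hχg' : ∀ r, 0 < r → χ =ᶠ[nhds r] g := fun r hr => by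
    filter_upwards [Ioi_mem_nhds hr] with y hy using hχg y hy
  refine ⟨χ, ?_, ?_, ?_, hχR, ?_, ?_⟩
  · rw [contDiff_iff_contDiffAt]
    intro r
    rcases lt_or_ge r R with h | h
    · refine (contDiffAt_const (c := (1 : ℝ))).congr_of_eventuallyEq ?_
      filter_upwards [Iio_mem_nhds h] with y hy using hχR y (le_of_lt hy)
    · have hr : 0 < r := hR.trans_le h
      refine ContDiffAt.congr_of_eventuallyEq ?_ (hχg' r hr)
      exact smoothTransition.contDiffAt.comp r
        ((contDiffAt_const.sub ((contDiffAt_w hr.le).log (w_pos hδ hr).ne')).div_const A)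
  · intro r
    simp only [hχ]
    split_ifs
    exacts [zero_le_one, smoothTransition.nonneg _]
  · intro r
    simp only [hχ]
    split_ifs
    exacts [le_rfl, smoothTransition.le_one _]
  · intro r hr
    rw [← w_lt_half_iff hδ hr]
    rcases hr.eq_or_lt with rfl | hr
    · rw [hχR 0 hR.le]
      simp [w]
    · have h0 : g r ≠ 0 ↔ 0 < (log (1 / 2) - log (w δ r)) / A := by
        constructor
        · intro h
          by_contra h'
          exact h (smoothTransition.zero_of_nonpos (not_lt.mp h'))
        · intro h
          exact (smoothTransition.pos_of_pos h).ne'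
      rw [hχg r hr, h0, div_pos_iff_of_pos_right hA, sub_pos,
        log_lt_log_iff (w_pos hδ hr) (by norm_num)]
  · intro r hr
    have hw := w_pos hδ hr
    have hwd := wd_pos hδ hr.le
    have hin : HasDerivAt (fun r => (log (1 / 2) - log (w δ r)) / A)
        (-(wd δ r / w δ r) / A) r :=
      (((hasDerivAt_w hr.le).log hw.ne').const_sub _).div_const A
    have hT : HasDerivAt smoothTransition
        (deriv smoothTransition ((log (1 / 2) - log (w δ r)) / A))
        ((log (1 / 2) - log (w δ r)) / A) :=
      ((smoothTransition.contDiff (n := 1)).differentiable one_ne_zero _).hasDerivAt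
    have hg' := (hT.comp r hin).deriv
    change deriv g r = _ at hg'
    rw [(hχg' r hr).deriv_eq, hg']
    set s := deriv smoothTransition ((log (1 / 2) - log (w δ r)) / A)
    have : w δ r * (s * (-(wd δ r / w δ r) / A)) = -(s * (wd δ r / A)) := by
      field_simp
    rw [this, abs_neg, abs_mul, abs_of_pos (div_pos hwd hA)]
    calc |s| * (wd δ r / A) ≤ L * (wd δ r / A) := by
          gcongr
          exact hL _
      _ = _ := by ring

/-- A bound for the `h`-dependent error of a profile vanishing beyond `R₀`. -/
theorem exists_error_bound {ψ : ℝ → ℝ} {δ R₀ : ℝ} (hδ : 0 < δ)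
    (hψ : ContDiff ℝ (⊤ : ℕ∞) ψ) (hzero : ∀ r, R₀ < r → ψ r = 0) :
    ∃ C > (0 : ℝ), ∀ r, 0 < r →
      wd δ r * deriv ψ r + w δ r * deriv (deriv ψ) r ≤ C * wd δ r := by
  have hψ1 := (contDiff_infty_iff_deriv.mp hψ).2
  have hψ2 := (contDiff_infty_iff_deriv.mp hψ1).2
  have hwdc : ContinuousOn (wd δ) (Icc 0 R₀) := fun r hr =>
    ((continuousAt_const.add continuousAt_id).rpow_const
      (Or.inl (by simp; linarith [hr.1]))).const_mul δ |>.continuousWithinAt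
  have hq : ContinuousOn (fun r => deriv ψ r + w δ r / wd δ r * deriv (deriv ψ) r)
      (Icc 0 R₀) :=
    hψ1.continuous.continuousOn.add <|
      (ContinuousOn.div (fun r hr => (contDiffAt_w hr.1).continuousAt.continuousWithinAt) hwdc
        fun r hr => (wd_pos hδ hr.1).ne').mul hψ2.continuous.continuousOn
  obtain ⟨C, hC⟩ := isCompact_Icc.exists_bound_of_continuousOn hq
  refine ⟨max C 1, by positivity, fun r hr => ?_⟩
  have hwd := wd_pos hδ hr.le
  rcases le_or_gt r R₀ with h | h
  · have := (le_abs_self _).trans ((hC r ⟨hr.le, h⟩).trans (le_max_left C 1))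
    calc wd δ r * deriv ψ r + w δ r * deriv (deriv ψ) r
        = (deriv ψ r + w δ r / wd δ r * deriv (deriv ψ) r) * wd δ r := by field_simp
      _ ≤ _ := by gcongr
  · have h0 : ψ =ᶠ[nhds r] fun _ => 0 := by
      filter_upwards [Ioi_mem_nhds h] with y hy using hzero y hy
    have h1 : deriv ψ =ᶠ[nhds r] fun _ => 0 := by
      simpa using h0.deriv
    rw [h1.deriv_eq, h1.eq_of_nhds, deriv_const]
    simp only [mul_zero, add_zero]
    positivity

/-- **Carleman weight lemma.** If `δ > 0` is small enough, there are
`h₀, R₀ > 0` and a smooth `φ` with `φ' ≥ 0` and `supp φ' = [0, R₀]` such that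
`∂_r (w (E - V_h + φ'² - h φ'')) ≥ E w' / 4` for all `h ∈ (0, h₀]`, `r > 0`, `ω ∈ S^{n-1}`. -/
theorem carleman_weight_lemma
    (n : ℕ) (E δ₀ : ℝ) (hE : 0 < E) (hδ₀ : 0 < δ₀) (hδ₀' : δ₀ < 1)
    -- `V h r ω` is the potential at semiclassical parameter `h`, radius `r`, angle `ω`;
    -- `Vr h r ω` is its (radial) `r`-derivative
    (V Vr : ℝ → ℝ → Metric.sphere (0 : EuclideanSpace ℝ (Fin n)) 1 → ℝ)
    (hVbdd : ∀ h, 0 < h → ∃ M : ℝ, ∀ r ω, |V h r ω| ≤ M)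
    (hVrbdd : ∀ h, 0 < h → ∃ M : ℝ, ∀ r ω, |Vr h r ω| ≤ M)
    (hVderiv : ∀ h, 0 < h → ∀ ω, ∀ r, 0 < r → HasDerivAt (fun t => V h t ω) (Vr h r ω) r)
    (hVle : ∀ h, 0 < h → ∀ r, 0 < r → ∀ ω, V h r ω ≤ (1 + r) ^ (-δ₀))
    (hVrle : ∀ h, 0 < h → ∀ r, 0 < r → ∀ ω, Vr h r ω ≤ (1 + r) ^ (-1 - δ₀)) :
    ∃ δ₁ > (0 : ℝ), ∀ δ, 0 < δ → δ < δ₀ → δ ≤ δ₁ →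
      ∃ h₀ > (0 : ℝ), ∃ R₀ > (0 : ℝ), ∃ φ : ℝ → ℝ,
        ContDiff ℝ (⊤ : ℕ∞) φ ∧
        (∀ r, 0 ≤ r → 0 ≤ deriv φ r) ∧
        closure {r : ℝ | 0 ≤ r ∧ deriv φ r ≠ 0} = Set.Icc 0 R₀ ∧
        ∀ h, 0 < h → h ≤ h₀ → ∀ r, 0 < r → ∀ ω, ∃ D : ℝ,
          HasDerivAt
            (fun t => w δ t * (E - V h t ω + (deriv φ t) ^ 2 - h * deriv (deriv φ) t)) D r ∧
          E * wd δ r / 4 ≤ D := by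
  obtain ⟨L, hL0, hL⟩ := exists_bound_deriv_smoothTransition
  set K : ℝ := 1 + 4 / δ₀
  have hK0 : 0 < K := by positivity
  obtain ⟨R, hR1, hR⟩ : ∃ R : ℝ, 0 < R ∧ ∀ r ≥ R, K * (1 + r) ^ (-(δ₀ / 4)) ≤ E / 4 := by
    have ht : Filter.Tendsto (fun r : ℝ => K * (1 + r) ^ (-(δ₀ / 4))) Filter.atTop
        (nhds (K * 0)) :=
      ((tendsto_rpow_neg_atTop (by positivity : 0 < δ₀ / 4)).comp
        (Filter.tendsto_atTop_add_const_left _ 1 Filter.tendsto_id)).const_mul K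
    rw [mul_zero] at ht
    obtain ⟨R, hR⟩ := Filter.eventually_atTop.mp
      (ht.eventually_le_const (by positivity : (0 : ℝ) < E / 4))
    exact ⟨max R 1, by positivity, fun r hr => hR r ((le_max_left _ _).trans hr)⟩
  set A : ℝ := 8 * K * L / E with hA
  have hA0 : 0 < A := by positivity
  have hlogR : 0 < log (1 + R) := log_pos (by linarith)
  refine ⟨min (δ₀ / 2) (exp (-A) / 2 / log (1 + R)), by positivity, ?_⟩
  intro δ hδ _ hδ₁
  obtain ⟨χ, hχ, hχ0, hχ1, hχR, hsupp, hχd⟩ := exists_cutoff hL hA0 hδ hR1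
    ((le_div_iff₀ hlogR).mp (hδ₁.trans (min_le_right _ _)))
  set R₀ : ℝ := 2 ^ (1 / δ) - 1
  have hR₀0 : 0 < R₀ := (hsupp 0 le_rfl).mp (by simp [hχR 0 hR1.le])
  set ψ : ℝ → ℝ := fun r => √K * χ r with hψ
  have hψs : ContDiff ℝ (⊤ : ℕ∞) ψ := contDiff_const.mul hχ
  obtain ⟨C, hC0, hC⟩ := exists_error_bound (R₀ := R₀) hδ hψs fun r hr => by
    have := (hsupp r (hR₀0.trans hr).le).not.mpr (not_lt.mpr hr.le)
    simp only [hψ, not_not.mp this, mul_zero]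
  set φ : ℝ → ℝ := fun r => ∫ t in (0 : ℝ)..r, ψ t
  have hφd : ∀ r, HasDerivAt φ (ψ r) r := fun r =>
    hψs.continuous.integral_hasStrictDerivAt 0 r |>.hasDerivAt
  have hφψ : deriv φ = ψ := funext fun r => (hφd r).deriv
  refine ⟨E / (4 * C), by positivity, R₀, hR₀0, φ, ?_, ?_, ?_, ?_⟩
  · rw [contDiff_infty_iff_deriv, hφψ]
    exact ⟨fun r => (hφd r).differentiableAt, hψs⟩
  · intro r _
    rw [hφψ]
    exact mul_nonneg (sqrt_nonneg _) (hχ0 r)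
  · have : {r : ℝ | 0 ≤ r ∧ deriv φ r ≠ 0} = Ico 0 R₀ := by
      ext r
      rw [hφψ]
      simp only [hψ, mem_ofPred_eq, mem_Ico, mul_ne_zero_iff]
      refine and_congr_right fun hr => ?_
      rw [← hsupp r hr]
      exact and_iff_right (sqrt_pos.mpr hK0).ne'
    rw [this, closure_Ico hR₀0.ne]
  · intro h hh hhle r hr ω
    have hψ1 := (contDiff_infty_iff_deriv.mp hψs).2
    have hdψ : HasDerivAt ψ (deriv ψ r) r :=
      ((contDiff_infty_iff_deriv.mp hψs).1 r).hasDerivAt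
    have hddψ : HasDerivAt (deriv ψ) (deriv (deriv ψ) r) r :=
      ((contDiff_infty_iff_deriv.mp hψ1).1 r).hasDerivAt
    rw [hφψ]
    refine ⟨_, (hasDerivAt_w hr.le).mul ((((hVderiv h hh ω r hr).const_sub E).add
      (hdψ.pow 2)).sub (hddψ.const_mul h)), ?_⟩
    have hwd := wd_pos hδ hr.le
    have hpot := potential_le hδ hδ₀ (hδ₁.trans (min_le_left _ _)) hr
      (hVle h hh r hr ω) (hVrle h hh r hr ω)
    have herr : h * (wd δ r * deriv ψ r + w δ r * deriv (deriv ψ) r) ≤ E / 4 * wd δ r :=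
      calc h * (wd δ r * deriv ψ r + w δ r * deriv (deriv ψ) r) ≤ h * (C * wd δ r) := by
            gcongr
            exact hC r hr
        _ ≤ E / (4 * C) * (C * wd δ r) := by gcongr
        _ = _ := by field_simp
    have hdχ : deriv ψ r = √K * deriv χ r := by
      simp only [hψ, deriv_const_mul_field]
    have hsq : √K * √K = K := mul_self_sqrt hK0.le
    have hdec : -(E / 4 * wd δ r) ≤ 2 * w δ r * ψ r * deriv ψ r := by
      have hLA : L / A = E / (8 * K) := by
        rw [hA]
        field_simp
      have habs : |χ r * (w δ r * deriv χ r)| ≤ E / (8 * K) * wd δ r := by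
        rw [abs_mul, abs_of_nonneg (hχ0 r), ← hLA]
        exact (mul_le_of_le_one_left (abs_nonneg _) (hχ1 r)).trans (hχd r hr)
      calc -(E / 4 * wd δ r) = 2 * K * -(E / (8 * K) * wd δ r) := by
            field_simp
            norm_num
        _ ≤ 2 * K * (χ r * (w δ r * deriv χ r)) := by
            gcongr
            exact (abs_le.mp habs).1
        _ = 2 * w δ r * ψ r * deriv ψ r := by
            rw [hdχ]
            simp only [hψ]
            linear_combination -(2 * w δ r * χ r * deriv χ r) * hsq
    have hmain : wd δ r * (K * (1 + r) ^ (-(δ₀ / 4))) ≤ wd δ r * (ψ r ^ 2 + E / 4) := by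
      gcongr
      rcases le_or_gt r R with hrR | hrR
      · have : (1 + r) ^ (-(δ₀ / 4)) ≤ 1 :=
          rpow_le_one_of_one_le_of_nonpos (by linarith) (by linarith)
        have hψK : ψ r ^ 2 = K := by
          simp only [hψ, hχR r hrR, mul_one]
          exact sq_sqrt hK0.le
        rw [hψK]
        nlinarith
      · exact (hR r hrR.le).trans (by linarith [sq_nonneg (ψ r)])
    push_cast
    nlinarith
end

section
/- Let 0 < δ₀ < 1. For all sufficiently small δ ∈ (0, δ₀), one has G_δ(r) ≤ δ₀^{-1} for every r > 0, where G_δ(r) := (1+r)^{-δ₀} + δ^{-1}(1 - (1+r)^{-δ})(1+r)^{δ-δ₀}. -/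
open MeasureTheory Real Set Topology Filter Asymptotics

/-- `G_δ(r) = (1+r)^{-δ₀} + δ⁻¹ (1 - (1+r)^{-δ}) (1+r)^{δ-δ₀}`. -/
noncomputable def G (δ₀ δ r : ℝ) : ℝ :=
  (1 + r) ^ (-δ₀) + δ⁻¹ * (1 - (1 + r) ^ (-δ)) * (1 + r) ^ (δ - δ₀)

theorem G_eq {δ₀ δ r : ℝ} (hr : 0 < 1 + r) :
    G δ₀ δ r = (1 + r) ^ (-δ₀) * (1 + δ⁻¹ * ((1 + r) ^ δ - 1)) := by
  have hδ : (1 + r) ^ δ ≠ 0 := (rpow_pos_of_pos hr δ).ne'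
  rw [G, sub_eq_add_neg δ δ₀, rpow_add hr, rpow_neg hr.le δ]
  linear_combination -δ⁻¹ * (1 + r) ^ (-δ₀) * inv_mul_cancel₀ hδ

/-- Let `0 < δ₀ < 1`. For all sufficiently small `δ ∈ (0, δ₀)`,
`G_δ(r) ≤ δ₀⁻¹` for every `r > 0`. -/
theorem G_le_inv_delta0
    (δ₀ : ℝ) (hδ₀ : 0 < δ₀) (hδ₀' : δ₀ < 1) :
    ∃ δ₁ > (0 : ℝ), ∀ δ, 0 < δ → δ < δ₀ → δ ≤ δ₁ → ∀ r, 0 < r → G δ₀ δ r ≤ δ₀⁻¹ := by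
  refine ⟨1, one_pos, fun δ hδ hδδ₀ _ r hr => ?_⟩
  have hu : (0 : ℝ) < 1 + r := by linarith
  rw [G_eq hu]
  have hbernoulli : 1 + δ₀ / δ * ((1 + r) ^ δ - 1) ≤ (1 + r) ^ δ₀ := by
    have h := one_add_mul_self_le_rpow_one_add (s := (1 + r) ^ δ - 1) (p := δ₀ / δ)
      (by linarith [rpow_pos_of_pos hu δ]) ((one_le_div hδ).2 hδδ₀.le)
    rwa [add_sub_cancel, ← rpow_mul hu.le, mul_div_cancel₀ _ hδ.ne'] at h
  rw [rpow_neg hu.le, inv_mul_le_iff₀ (rpow_pos_of_pos hu δ₀), ← div_eq_mul_inv, le_div_iff₀ hδ₀]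
  calc (1 + δ⁻¹ * ((1 + r) ^ δ - 1)) * δ₀ = δ₀ + δ₀ / δ * ((1 + r) ^ δ - 1) := by ring
    _ ≤ (1 + r) ^ δ₀ := by linarith
end

section
/- Let 0 < δ₀ < 1 and E > 0. Define R = R(δ) > 0 by (1+R)^{δ-δ₀} = δE/4. Then for all sufficiently small δ ∈ (0, δ₀): G_δ(r) ≤ E/4 for every r ≥ R. (Indeed G_δ(R) ≤ δ^{-1}(1+R)^{δ-δ₀} = E/4, and for δ small (1+R)^δ = (δE/4)^{-δ/(δ₀-δ)} = 1 + δ₀^{-1}δ|ln δ| + O(δ) exceeds (1+r_max)^δ, so G_δ is decreasing on [R,∞).) -/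
open MeasureTheory Real Set Topology Filter Asymptotics

/-- For `0 < δ ≤ 1`, the function `G_δ` is dominated by the decreasing power `δ⁻¹ (1+r)^{δ-δ₀}`
(for `δ < δ₀`). -/
theorem G_le_inv_mul_rpow {δ₀ δ r : ℝ} (hδ : 0 < δ) (hδ1 : δ ≤ 1) (hr : 0 < 1 + r) :
    G δ₀ δ r ≤ δ⁻¹ * (1 + r) ^ (δ - δ₀) := by
  have hmul : (1 + r) ^ (-δ) * (1 + r) ^ (δ - δ₀) = (1 + r) ^ (-δ₀) := by
    rw [← Real.rpow_add hr]
    congr 1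
    ring
  have hG : G δ₀ δ r = δ⁻¹ * (1 + r) ^ (δ - δ₀) - (δ⁻¹ - 1) * (1 + r) ^ (-δ₀) := by
    rw [G, ← hmul]
    ring
  rw [hG]
  exact sub_le_self _ <|
    mul_nonneg (sub_nonneg.2 (one_le_inv_iff₀.2 ⟨hδ, hδ1⟩)) (Real.rpow_nonneg hr.le _)

/-- With `R = R(δ)` defined by `(1+R)^{δ-δ₀} = δE/4`, for all sufficiently
small `δ ∈ (0, δ₀)` one has `G_δ(r) ≤ E/4` for every `r ≥ R`. -/
theorem G_small_beyond_R
    (δ₀ E : ℝ) (hδ₀ : 0 < δ₀) (hδ₀' : δ₀ < 1) (hE : 0 < E) :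
    ∃ δ₁ > (0 : ℝ), ∀ δ, 0 < δ → δ < δ₀ → δ ≤ δ₁ →
      ∀ R, 0 < R → (1 + R) ^ (δ - δ₀) = δ * E / 4 →
        ∀ r, R ≤ r → G δ₀ δ r ≤ E / 4 := by
  refine ⟨1, one_pos, fun δ hδ hδδ₀ hδ1 R hR hRE r hr => ?_⟩
  calc G δ₀ δ r ≤ δ⁻¹ * (1 + r) ^ (δ - δ₀) := G_le_inv_mul_rpow hδ hδ1 (by linarith)
    _ ≤ δ⁻¹ * (1 + R) ^ (δ - δ₀) :=
      mul_le_mul_of_nonneg_left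
        (Real.rpow_le_rpow_of_nonpos (by linarith) (by linarith) (by linarith)) (inv_pos.2 hδ).le
    _ = E / 4 := by
      rw [hRE]
      field_simp
end

section
/- Let 0 < δ₀ < 1 and E > 0, and define R = R(δ) > 0 by (1+R)^{δ-δ₀} = δE/4, so that w(R) = 1 - (δE/4)^{δ/(δ₀-δ)}. Then w(R) = O(δ|ln δ|) as δ → 0⁺, and in particular for all sufficiently small δ ∈ (0, δ₀) one has w(R) < 1/(1 + 4δ₀^{-1}E^{-1}). -/
open MeasureTheory Real Set Topology Filter Asymptotics

/-- If `(1+R)^{δ-δ₀} = a`, then `w(R) = 1 - a^{δ/(δ₀-δ)}`. -/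
theorem w_eq_of_rpow_eq {δ₀ δ R a : ℝ} (hδ : δ < δ₀) (hR : 0 < R)
    (h : (1 + R) ^ (δ - δ₀) = a) : w δ R = 1 - a ^ (δ / (δ₀ - δ)) := by
  have hne : δ₀ - δ ≠ 0 := (sub_pos.2 hδ).ne'
  rw [w, ← h, ← rpow_mul (by linarith)]
  congr 2
  field_simp
  ring

theorem one_sub_rpow_isBigO {δ₀ E : ℝ} (hδ₀ : 0 < δ₀) (hE : 0 < E) :
    (fun δ : ℝ => 1 - (δ * E / 4) ^ (δ / (δ₀ - δ))) =O[𝓝[>] 0]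
      (fun δ : ℝ => δ * |Real.log δ|) := by
  have hlog : ∀ᶠ δ in 𝓝[>] (0 : ℝ), Real.log δ ≤ -|Real.log (E / 4)| :=
    tendsto_log_nhdsGT_zero.eventually_le_atBot _
  have hsmall : ∀ᶠ δ in 𝓝[>] (0 : ℝ), δ < δ₀ / 2 :=
    nhdsWithin_le_nhds (eventually_lt_nhds (by positivity))
  refine IsBigO.of_bound (4 / δ₀) ?_
  filter_upwards [hlog, hsmall, self_mem_nhdsWithin] with δ hl hs (hpos : 0 < δ)
  have habs := abs_le.1 (le_refl |Real.log (E / 4)|)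
  have hlogδ : |Real.log δ| = -Real.log δ :=
    abs_of_nonpos (hl.trans (neg_nonpos.2 (abs_nonneg _)))
  have hsum : Real.log (δ * E / 4) = Real.log δ + Real.log (E / 4) := by
    rw [mul_div_assoc, Real.log_mul hpos.ne' (by positivity)]
  have hexp : 0 ≤ δ / (δ₀ - δ) := div_nonneg hpos.le (by linarith)
  have hexp_le : δ / (δ₀ - δ) ≤ 2 * δ / δ₀ := by
    rw [div_le_div_iff₀ (by linarith) hδ₀]
    nlinarith
  rw [rpow_def_of_pos (by positivity), hsum]
  set x := (Real.log δ + Real.log (E / 4)) * (δ / (δ₀ - δ)) with hx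
  have hx_nonpos : x ≤ 0 := mul_nonpos_of_nonpos_of_nonneg (by linarith) hexp
  rw [norm_of_nonneg (sub_nonneg.2 (Real.exp_le_one_iff.2 hx_nonpos)),
    norm_of_nonneg (mul_nonneg hpos.le (abs_nonneg _))]
  calc 1 - Real.exp x ≤ -(Real.log δ + Real.log (E / 4)) * (δ / (δ₀ - δ)) := by
        rw [neg_mul, ← hx]
        linarith [Real.add_one_le_exp x]
    _ ≤ 2 * |Real.log δ| * (2 * δ / δ₀) := by
        rw [hlogδ]
        exact mul_le_mul (by linarith) hexp_le hexp (by linarith [abs_nonneg (Real.log (E / 4))])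
    _ = 4 / δ₀ * (δ * |Real.log δ|) := by ring

theorem tendsto_mul_abs_log_nhdsGT_zero :
    Tendsto (fun δ : ℝ => δ * |Real.log δ|) (𝓝[>] 0) (𝓝 0) := by
  have h : Tendsto (fun δ : ℝ => |δ * Real.log δ|) (𝓝[>] 0) (𝓝 0) := by
    have := (Real.continuous_mul_log.abs.tendsto 0).mono_left
      (nhdsWithin_le_nhds (s := Set.Ioi 0))
    simpa using this
  refine h.congr' ?_
  filter_upwards [self_mem_nhdsWithin] with δ (hδ : 0 < δ)
  rw [abs_mul, abs_of_pos hδ]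

/-- With `R = R(δ)` defined by `(1+R)^{δ-δ₀} = δE/4`, one has
`w(R) = 1 - (δE/4)^{δ/(δ₀-δ)} = O(δ|ln δ|)` as `δ → 0⁺`; in particular, for all
sufficiently small `δ ∈ (0,δ₀)`, `w(R) < 1/(1 + 4 δ₀⁻¹ E⁻¹)`. -/
theorem wR_small
    (δ₀ E : ℝ) (hδ₀ : 0 < δ₀) (hδ₀' : δ₀ < 1) (hE : 0 < E) :
    (∀ δ, 0 < δ → δ < δ₀ → δ * E / 4 < 1 →
      ∀ R, 0 < R → (1 + R) ^ (δ - δ₀) = δ * E / 4 →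
        w δ R = 1 - (δ * E / 4) ^ (δ / (δ₀ - δ))) ∧
    (fun δ : ℝ => 1 - (δ * E / 4) ^ (δ / (δ₀ - δ))) =O[𝓝[>] 0]
      (fun δ : ℝ => δ * |Real.log δ|) ∧
    ∃ δ₁ > (0 : ℝ), ∀ δ, 0 < δ → δ < δ₀ → δ ≤ δ₁ →
      ∀ R, 0 < R → (1 + R) ^ (δ - δ₀) = δ * E / 4 →
        w δ R < 1 / (1 + 4 * δ₀⁻¹ * E⁻¹) := by
  refine ⟨fun δ _ hδ _ R hR h => w_eq_of_rpow_eq hδ hR h, one_sub_rpow_isBigO hδ₀ hE, ?_⟩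
  have hc : 0 < 1 / (1 + 4 * δ₀⁻¹ * E⁻¹) := by positivity
  have hlt := ((one_sub_rpow_isBigO hδ₀ hE).trans_tendsto
    tendsto_mul_abs_log_nhdsGT_zero).eventually_lt_const hc
  obtain ⟨δ₁, hδ₁, hsub⟩ := mem_nhdsGT_iff_exists_Ioc_subset.1 hlt
  refine ⟨δ₁, hδ₁, fun δ hpos hδ hle R hR h => ?_⟩
  rw [w_eq_of_rpow_eq hδ hR h]
  exact hsub ⟨hpos, hle⟩
end
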